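/- For every integer r > 0 there exists a finite induced subgraph G of the infinite square grid ℤ² (with edges between points at L¹-distance 1) and an edge labeling l of G into {N, F} such that G admits no threshold-coloring with respect to l using fewer than r distinct colors, for any threshold t ≥ 0. -/

import Mathlib

/-- The vertical edges `(x, y) - (x, y + 1)` of the square spiral
`(0, 0), (1, 0), (1, 1), (0, 1), (-1, 1), …` through all points of `ℤ²`. -/
def SpiralVert (x y : ℤ) : Prop := (1 ≤ x ∧ -x < y ∧ y < x) ∨ (x ≤ 0 ∧ x ≤ y ∧ y < -x)

/-- The horizontal edges `(x, y) - (x + 1, y)` of the same spiral. -/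
def SpiralHoriz (x y : ℤ) : Prop := (1 ≤ y ∧ -y ≤ x ∧ x < y) ∨ (y ≤ 0 ∧ y ≤ x ∧ x ≤ -y)

/-- `c` is a threshold-coloring of the box `[-M, M]²` in which exactly the spiral edges are near. -/
structure IsSpiralColoring (M t : ℤ) (c : ℤ × ℤ → ℤ) : Prop where
  vert : ∀ x y, -M ≤ x → x ≤ M → -M ≤ y → y + 1 ≤ M →
    (|c (x, y) - c (x, y + 1)| ≤ t ↔ SpiralVert x y)
  horiz : ∀ x y, -M ≤ x → x + 1 ≤ M → -M ≤ y → y ≤ M →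
    (|c (x, y) - c (x + 1, y)| ≤ t ↔ SpiralHoriz x y)

/-- Along a ladder with near rails and far rungs, all rungs point in the same direction. -/
theorem ladder_lt {t : ℤ} {n : ℕ} (a b : ℕ → ℤ) (h0 : a 0 + t < b 0)
    (ha : ∀ j < n, |a j - a (j + 1)| ≤ t) (hb : ∀ j < n, |b j - b (j + 1)| ≤ t)
    (hab : ∀ j < n, t < |a (j + 1) - b (j + 1)|) : a n + t < b n := by
  induction n with
  | zero => exact h0
  | succ n ih =>
    have h := ih (fun j hj => ha j (by omega)) (fun j hj => hb j (by omega))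
      (fun j hj => hab j (by omega))
    have h1 := abs_le.1 (ha n (by omega))
    have h2 := abs_le.1 (hb n (by omega))
    rcases lt_abs.1 (hab n (by omega)) with h3 | h3 <;> omega

/-- In a four-cycle with two near edges at `m`, the far edges at the opposite vertex `a` point
in the same direction. -/
theorem corner_lt {t a b m d : ℤ} (h : a + t < b) (hbm : |b - m| ≤ t) (hmd : |m - d| ≤ t)
    (had : t < |a - d|) : a + t < d := by
  have h1 := abs_le.1 hbm
  have h2 := abs_le.1 hmd
  rcases lt_abs.1 had with h3 | h3 <;> omega

namespace IsSpiralColoring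

variable {M t : ℤ} {c : ℤ × ℤ → ℤ}

theorem neg (h : IsSpiralColoring M t c) : IsSpiralColoring M t (fun p => -c p) where
  vert x y h1 h2 h3 h4 := by
    rw [← h.vert x y h1 h2 h3 h4, ← abs_neg]; ring_nf
  horiz x y h1 h2 h3 h4 := by
    rw [← h.horiz x y h1 h2 h3 h4, ← abs_neg]; ring_nf

theorem near_vert (h : IsSpiralColoring M t c) {x y z : ℤ} (hz : z = y + 1) (hx : -M ≤ x)
    (hx' : x ≤ M) (hy : -M ≤ y) (hy' : z ≤ M) (hs : SpiralVert x y) :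
    |c (x, y) - c (x, z)| ≤ t := by
  subst hz; exact (h.vert x y hx hx' hy hy').2 hs

theorem far_vert (h : IsSpiralColoring M t c) {x y z : ℤ} (hz : z = y + 1) (hx : -M ≤ x)
    (hx' : x ≤ M) (hy : -M ≤ y) (hy' : z ≤ M) (hs : ¬ SpiralVert x y) :
    t < |c (x, y) - c (x, z)| := by
  subst hz; exact not_le.1 (mt (h.vert x y hx hx' hy hy').1 hs)

theorem near_horiz (h : IsSpiralColoring M t c) {x y z : ℤ} (hz : z = x + 1) (hx : -M ≤ x)
    (hx' : z ≤ M) (hy : -M ≤ y) (hy' : y ≤ M) (hs : SpiralHoriz x y) :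
    |c (x, y) - c (z, y)| ≤ t := by
  subst hz; exact (h.horiz x y hx hx' hy hy').2 hs

theorem far_horiz (h : IsSpiralColoring M t c) {x y z : ℤ} (hz : z = x + 1) (hx : -M ≤ x)
    (hx' : z ≤ M) (hy : -M ≤ y) (hy' : y ≤ M) (hs : ¬ SpiralHoriz x y) :
    t < |c (x, y) - c (z, y)| := by
  subst hz; exact not_le.1 (mt (h.horiz x y hx hx' hy hy').1 hs)

/-- One turn of the spiral transports the direction of a far edge to the next ring. -/
theorem turn (h : IsSpiralColoring M t c) {k : ℕ} (hk : (k : ℤ) + 2 ≤ M)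
    (h0 : c (0, k) + t < c (0, k + 1)) : c (0, k + 1) + t < c (0, k + 1 + 1) := by
  have top_left : c (-k, k) + t < c (-k, k + 1) := by
    refine ladder_lt (n := k) (fun j => c (-j, k)) (fun j => c (-j, k + 1)) (by simpa using h0)
      (fun j hj => ?_) (fun j hj => ?_) (fun j hj => ?_)
    · rw [abs_sub_comm]
      apply h.near_horiz <;> (try unfold SpiralHoriz) <;> omega
    · rw [abs_sub_comm]
      apply h.near_horiz <;> (try unfold SpiralHoriz) <;> omega
    · apply h.far_vert <;> (try unfold SpiralVert) <;> omega
  have corner₁ : c (-k, k) + t < c (-k - 1, k) := by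
    refine corner_lt (m := c (-k - 1, k + 1)) top_left ?_ ?_ ?_ <;> rw [abs_sub_comm]
    · apply h.near_horiz <;> (try unfold SpiralHoriz) <;> omega
    · apply h.near_vert <;> (try unfold SpiralVert) <;> omega
    · apply h.far_horiz <;> (try unfold SpiralHoriz) <;> omega
  have left : c (-k, k - (2 * k : ℕ)) + t < c (-k - 1, k - (2 * k : ℕ)) := by
    refine ladder_lt (n := 2 * k) (fun j => c (-k, k - j)) (fun j => c (-k - 1, k - j))
      (by simpa using corner₁) (fun j hj => ?_) (fun j hj => ?_) (fun j hj => ?_) <;>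
      rw [abs_sub_comm]
    · apply h.near_vert <;> (try unfold SpiralVert) <;> omega
    · apply h.near_vert <;> (try unfold SpiralVert) <;> omega
    · apply h.far_horiz <;> (try unfold SpiralHoriz) <;> omega
  rw [show (k : ℤ) - (2 * k : ℕ) = -k by omega] at left
  have corner₂ : c (-k, -k) + t < c (-k, -k - 1) := by
    refine corner_lt (m := c (-k - 1, -k - 1)) left ?_ ?_ ?_
    · rw [abs_sub_comm]
      apply h.near_vert <;> (try unfold SpiralVert) <;> omega
    · apply h.near_horiz <;> (try unfold SpiralHoriz) <;> omega
    · rw [abs_sub_comm]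
      apply h.far_vert <;> (try unfold SpiralVert) <;> omega
  have bottom : c (-k + (2 * k + 1 : ℕ), -k) + t < c (-k + (2 * k + 1 : ℕ), -k - 1) := by
    refine ladder_lt (n := 2 * k + 1) (fun j => c (-k + j, -k)) (fun j => c (-k + j, -k - 1))
      (by simpa using corner₂) (fun j hj => ?_) (fun j hj => ?_) (fun j hj => ?_)
    · apply h.near_horiz <;> (try unfold SpiralHoriz) <;> omega
    · apply h.near_horiz <;> (try unfold SpiralHoriz) <;> omega
    · rw [abs_sub_comm]
      apply h.far_vert <;> (try unfold SpiralVert) <;> omega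
  rw [show -(k : ℤ) + (2 * k + 1 : ℕ) = k + 1 by omega] at bottom
  have corner₃ : c (k + 1, -k) + t < c (k + 2, -k) := by
    refine corner_lt (m := c (k + 2, -k - 1)) bottom ?_ ?_ ?_
    · apply h.near_horiz <;> (try unfold SpiralHoriz) <;> omega
    · apply h.near_vert <;> (try unfold SpiralVert) <;> omega
    · apply h.far_horiz <;> (try unfold SpiralHoriz) <;> omega
  have right : c (k + 1, -k + (2 * k + 1 : ℕ)) + t < c (k + 2, -k + (2 * k + 1 : ℕ)) := by
    refine ladder_lt (n := 2 * k + 1) (fun j => c (k + 1, -k + j)) (fun j => c (k + 2, -k + j))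
      (by simpa using corner₃) (fun j hj => ?_) (fun j hj => ?_) (fun j hj => ?_)
    · apply h.near_vert <;> (try unfold SpiralVert) <;> omega
    · apply h.near_vert <;> (try unfold SpiralVert) <;> omega
    · apply h.far_horiz <;> (try unfold SpiralHoriz) <;> omega
  rw [show -(k : ℤ) + (2 * k + 1 : ℕ) = k + 1 by omega] at right
  have corner₄ : c (k + 1, k + 1) + t < c (k + 1, k + 1 + 1) := by
    refine corner_lt (m := c (k + 2, k + 1 + 1)) right ?_ ?_ ?_
    · apply h.near_vert <;> (try unfold SpiralVert) <;> omega
    · rw [abs_sub_comm]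
      apply h.near_horiz <;> (try unfold SpiralHoriz) <;> omega
    · apply h.far_vert <;> (try unfold SpiralVert) <;> omega
  have top_right : c (k + 1 - (k + 1 : ℕ), k + 1) + t < c (k + 1 - (k + 1 : ℕ), k + 1 + 1) := by
    refine ladder_lt (n := k + 1) (fun j => c (k + 1 - j, k + 1))
      (fun j => c (k + 1 - j, k + 1 + 1)) (by simpa using corner₄)
      (fun j hj => ?_) (fun j hj => ?_) (fun j hj => ?_)
    · rw [abs_sub_comm]
      apply h.near_horiz <;> (try unfold SpiralHoriz) <;> omega
    · rw [abs_sub_comm]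
      apply h.near_horiz <;> (try unfold SpiralHoriz) <;> omega
    · apply h.far_vert <;> (try unfold SpiralVert) <;> omega
  simpa using top_right

/-- If the innermost far edge points outwards, then the colors increase along the ray. -/
theorem ray_step (h : IsSpiralColoring M t c) (h0 : c (0, 0) + t < c (0, 1)) (k : ℕ)
    (hk : (k : ℤ) + 1 ≤ M) : c (0, k) + t < c (0, k + 1) := by
  induction k with
  | zero => simpa using h0
  | succ k ih =>
    push_cast at hk ⊢
    exact h.turn (by omega) (ih (by omega))

theorem ray_lt (h : IsSpiralColoring M t c) (ht : 0 ≤ t)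
    (h0 : c (0, 0) + t < c (0, 1)) {i j : ℕ} (hij : i < j) (hj : (j : ℤ) ≤ M) :
    c (0, i) < c (0, j) := by
  induction j, hij using Nat.le_induction with
  | base =>
    have := h.ray_step h0 i (by omega)
    push_cast
    omega
  | succ j hij ih =>
    push_cast at hj ⊢
    have := ih (by omega)
    have := h.ray_step h0 j hj
    omega

theorem ray_ne (h : IsSpiralColoring M t c) (ht : 0 ≤ t) {i j : ℕ} (hij : i < j)
    (hj : (j : ℤ) ≤ M) : c (0, i) ≠ c (0, j) := by
  have h0 : t < |c (0, 0) - c (0, 1)| := by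
    apply h.far_vert <;> (try unfold SpiralVert) <;> omega
  rcases lt_abs.1 h0 with h0 | h0
  · have := h.neg.ray_lt ht (by omega) hij hj
    omega
  · exact (h.ray_lt ht (by omega) hij hj).ne

end IsSpiralColoring

open Classical in
/-- The labeling of the edges of `ℤ²` in which exactly the spiral edges are near. -/
noncomputable def spiralLabel (e : Sym2 (ℤ × ℤ)) : Bool :=
  decide (∃ x y, (e = s((x, y), (x, y + 1)) ∧ SpiralVert x y) ∨
    (e = s((x, y), (x + 1, y)) ∧ SpiralHoriz x y))

theorem spiralLabel_vert (x y : ℤ) :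
    spiralLabel s((x, y), (x, y + 1)) = true ↔ SpiralVert x y := by
  simp only [spiralLabel, decide_eq_true_eq, Sym2.eq_iff, Prod.mk.injEq]
  constructor
  · rintro ⟨a, b, ⟨h, hs⟩ | ⟨h, -⟩⟩
    · obtain ⟨rfl, rfl⟩ : x = a ∧ y = b := by omega
      exact hs
    · omega
  · exact fun hs => ⟨x, y, by simp [hs]⟩

theorem spiralLabel_horiz (x y : ℤ) :
    spiralLabel s((x, y), (x + 1, y)) = true ↔ SpiralHoriz x y := by
  simp only [spiralLabel, decide_eq_true_eq, Sym2.eq_iff, Prod.mk.injEq]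
  constructor
  · rintro ⟨a, b, ⟨h, -⟩ | ⟨h, hs⟩⟩
    · omega
    · obtain ⟨rfl, rfl⟩ : x = a ∧ y = b := by omega
      exact hs
  · exact fun hs => ⟨x, y, by simp [hs]⟩

/-- For every r > 0 there is a finite induced subgraph of the square lattice ℤ²
(edges between points at L¹-distance 1) and an edge labeling (`true` = near) such
that every threshold-coloring, for any threshold t ≥ 0, uses at least r colors. -/
theorem stmt13 (r : ℕ) (hr : 0 < r) :
    ∃ (V : Finset (ℤ × ℤ)) (l : Sym2 (ℤ × ℤ) → Bool),
      ∀ t : ℤ, 0 ≤ t → ∀ c : ℤ × ℤ → ℤ,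
        (∀ u v : ℤ × ℤ, u ∈ V → v ∈ V → |u.1 - v.1| + |u.2 - v.2| = 1 →
          (|c u - c v| ≤ t ↔ l s(u, v) = true)) →
        r ≤ (V.image c).card := by
  refine ⟨Finset.Icc (-r : ℤ) r ×ˢ Finset.Icc (-r : ℤ) r, spiralLabel, fun t ht c hc => ?_⟩
  have h : IsSpiralColoring r t c := by
    constructor <;> intro x y h1 h2 h3 h4
    · rw [← spiralLabel_vert]
      refine hc _ _ ?_ ?_ (by simp) <;> simp only [Finset.mem_product, Finset.mem_Icc] <;> omega
    · rw [← spiralLabel_horiz]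
      refine hc _ _ ?_ ?_ (by simp) <;> simp only [Finset.mem_product, Finset.mem_Icc] <;> omega
  have hinj : Set.InjOn (fun i : ℕ => c (0, i)) (Finset.range r) := by
    intro i hi j hj hij
    simp only [Finset.coe_range, Set.mem_Iio] at hi hj
    by_contra hne
    rcases lt_or_gt_of_ne hne with hlt | hlt
    · exact h.ray_ne ht hlt (by omega) hij
    · exact h.ray_ne ht hlt (by omega) hij.symm
  calc r = ((Finset.range r).image fun i : ℕ => c (0, i)).card := by
        rw [Finset.card_image_of_injOn hinj, Finset.card_range]
    _ ≤ _ := by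
        refine Finset.card_le_card fun a ha => ?_
        obtain ⟨i, hi, rfl⟩ := Finset.mem_image.1 ha
        refine Finset.mem_image_of_mem c ?_
        rw [Finset.mem_range] at hi
        simp only [Finset.mem_product, Finset.mem_Icc]
        omega
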